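/- (Theorem 1, total-variation form: smoothing makes the policy Lipschitz in context.) Let d ≥ 1, let (𝒜, Σ) be a measurable space, and let p be a Markov (probability) kernel from ℝ^d to 𝒜, i.e., for each c ∈ ℝ^d, p(·|c) is a probability measure on 𝒜 and c ↦ p(A|c) is measurable for every A ∈ Σ. Fix σ > 0, let γ = N(0, I_d) be the standard Gaussian measure on ℝ^d, and define the Gaussian context-smoothed kernel p_σ by p_σ(A|c) = ∫ p(A | c + σ·w) dγ(w) for all A ∈ Σ. Then for any two contexts c, c' ∈ ℝ^d, the total variation distance TV(p_σ(·|c), p_σ(·|c')) = sup_{A ∈ Σ} |p_σ(A|c) − p_σ(A|c')| satisfies TV(p_σ(·|c), p_σ(·|c')) ≤ (M_d / σ) · ‖c − c'‖, where M_d = ∫ ‖w‖ dγ(w). -/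

import Mathlib

open MeasureTheory Real

/-- The standard Gaussian measure `N(0, I_d)` on `ℝ^d`, given by its density
`(2π)^{-d/2} exp(-‖w‖²/2)` with respect to Lebesgue measure. -/
noncomputable def stdGaussian (d : ℕ) : Measure (EuclideanSpace ℝ (Fin d)) :=
  (volume : Measure (EuclideanSpace ℝ (Fin d))).withDensity
    (fun w => ENNReal.ofReal ((2 * π) ^ (-(d : ℝ) / 2) * Real.exp (-‖w‖ ^ 2 / 2)))

/-- Total variation distance: `TV(P,Q) = sup_{A measurable} |P(A) − Q(A)|`. -/
noncomputable def TV {𝒜 : Type*} [MeasurableSpace 𝒜] (P Q : Measure 𝒜) : ℝ :=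
  ⨆ A : {A : Set 𝒜 // MeasurableSet A}, |(P A.1).toReal - (Q A.1).toReal|

/-- The Gaussian context-smoothed kernel `p_σ(·|c) = ∫ p(· | c + σ·w) dγ(w)`, as a
measure on the action space, for each context `c`. -/
noncomputable def smoothedKernel (d : ℕ) (σ : ℝ) {𝒜 : Type*} [MeasurableSpace 𝒜]
    (p : ProbabilityTheory.Kernel (EuclideanSpace ℝ (Fin d)) 𝒜)
    (c : EuclideanSpace ℝ (Fin d)) : Measure 𝒜 :=
  (stdGaussian d).bind (fun w => p (c + σ • w))

/-- The `L¹` modulus of continuity of a `C¹` function under translation is controlled by the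
`L¹` norm of its derivative. -/
theorem lintegral_enorm_comp_add_sub_le {E F : Type*} [NormedAddCommGroup E] [NormedSpace ℝ E]
    [FiniteDimensional ℝ E] [MeasurableSpace E] [BorelSpace E]
    [NormedAddCommGroup F] [NormedSpace ℝ F] (μ : Measure E) [SFinite μ] [μ.IsAddRightInvariant]
    {f : E → F} (hf : ContDiff ℝ 1 f) (v : E) :
    ∫⁻ x, ‖f (x + v) - f x‖ₑ ∂μ ≤ ‖v‖ₑ * ∫⁻ x, ‖fderiv ℝ f x‖ₑ ∂μ := by
  have hcont : Continuous (fderiv ℝ f) := hf.continuous_fderiv one_ne_zero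
  have hpt (x : E) : ‖f (x + v) - f x‖ₑ ≤
      ∫⁻ t in Set.Icc (0 : ℝ) 1, ‖v‖ₑ * ‖fderiv ℝ f (x + t • v)‖ₑ := by
    have hline : ContDiff ℝ 1 (fun t : ℝ => f (x + t • v)) := by fun_prop
    have h := enorm_sub_le_lintegral_deriv_of_contDiffOn_Icc hline.contDiffOn zero_le_one
    simp only [one_smul, zero_smul, add_zero] at h
    refine h.trans (lintegral_mono fun t => ?_)
    have hd : HasDerivAt (fun t : ℝ => f (x + t • v)) (fderiv ℝ f (x + t • v) v) t := by
      refine (hf.differentiable one_ne_zero _).hasFDerivAt.comp_hasDerivAt t ?_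
      simpa using ((hasDerivAt_id t).smul_const v).const_add x
    rw [hd.deriv, mul_comm]
    exact ContinuousLinearMap.le_opENorm _ _
  calc ∫⁻ x, ‖f (x + v) - f x‖ₑ ∂μ
      ≤ ∫⁻ x, (∫⁻ t in Set.Icc (0 : ℝ) 1, ‖v‖ₑ * ‖fderiv ℝ f (x + t • v)‖ₑ) ∂μ :=
        lintegral_mono hpt
    _ = ∫⁻ t in Set.Icc (0 : ℝ) 1, ∫⁻ x, ‖v‖ₑ * ‖fderiv ℝ f (x + t • v)‖ₑ ∂μ := by
      refine lintegral_lintegral_swap (Measurable.aemeasurable ?_)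
      have : Continuous fun z : E × ℝ => ‖fderiv ℝ f (z.1 + z.2 • v)‖ₑ := by fun_prop
      exact this.measurable.const_mul _
    _ = ‖v‖ₑ * ∫⁻ x, ‖fderiv ℝ f x‖ₑ ∂μ := by
      have h (t : ℝ) : ∫⁻ x, ‖v‖ₑ * ‖fderiv ℝ f (x + t • v)‖ₑ ∂μ =
          ‖v‖ₑ * ∫⁻ x, ‖fderiv ℝ f x‖ₑ ∂μ := by
        rw [lintegral_add_right_eq_self (fun x => ‖v‖ₑ * ‖fderiv ℝ f x‖ₑ),
          lintegral_const_mul _ hcont.enorm.measurable]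
      simp [h]

section GaussianDensity

variable {E : Type*} [NormedAddCommGroup E] [InnerProductSpace ℝ E]

theorem hasFDerivAt_exp_neg_norm_sq_div_two (k : ℝ) (x : E) :
    HasFDerivAt (fun w : E => k * Real.exp (-‖w‖ ^ 2 / 2))
      ((k * Real.exp (-‖x‖ ^ 2 / 2)) • -innerSL ℝ x) x := by
  have h : HasFDerivAt (fun w : E => -‖w‖ ^ 2 / 2) (-innerSL ℝ x) x := by
    have h2 := ((hasFDerivAt_id x).norm_sq).const_mul (-1 / 2 : ℝ)
    refine (h2.congr_fderiv ?_).congr_of_eventuallyEq (.of_forall fun w => ?_)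
    · ext y; simp; ring
    · simp; ring
  exact (h.exp.const_mul k).congr_fderiv (by rw [smul_smul])

theorem enorm_fderiv_exp_neg_norm_sq_div_two {k : ℝ} (hk : 0 ≤ k) (x : E) :
    ‖fderiv ℝ (fun w : E => k * Real.exp (-‖w‖ ^ 2 / 2)) x‖ₑ =
      ENNReal.ofReal ((k * Real.exp (-‖x‖ ^ 2 / 2)) * ‖x‖) := by
  rw [(hasFDerivAt_exp_neg_norm_sq_div_two k x).fderiv, ← ofReal_norm, norm_smul, norm_neg,
    innerSL_apply_norm, Real.norm_of_nonneg (by positivity)]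

variable [FiniteDimensional ℝ E] [MeasurableSpace E] [BorelSpace E]

theorem integrable_exp_neg_mul_norm_sq {b : ℝ} (hb : 0 < b) :
    Integrable (fun w : E => Real.exp (-b * ‖w‖ ^ 2)) := by
  by_contra h
  have h0 := GaussianFourier.integral_rexp_neg_mul_sq_norm (V := E) hb
  rw [integral_undef h] at h0
  exact (by positivity : (0 : ℝ) < (π / b) ^ (Module.finrank ℝ E / 2 : ℝ)).ne h0

theorem integrable_exp_neg_norm_sq_div_two (k : ℝ) :
    Integrable (fun w : E => k * Real.exp (-‖w‖ ^ 2 / 2)) := by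
  refine ((integrable_exp_neg_mul_norm_sq (E := E) one_half_pos).const_mul k).congr
    (.of_forall fun w => ?_)
  ring_nf

theorem integrable_exp_neg_norm_sq_div_two_mul_norm (k : ℝ) :
    Integrable (fun w : E => (k * Real.exp (-‖w‖ ^ 2 / 2)) * ‖w‖) := by
  refine ((integrable_exp_neg_mul_norm_sq (E := E) (b := 1 / 4) (by norm_num)).const_mul |k|).mono'
    (Continuous.aestronglyMeasurable (by fun_prop)) (.of_forall fun w => ?_)
  have h : ‖w‖ ≤ Real.exp (‖w‖ ^ 2 / 4) := by
    nlinarith [Real.add_one_le_exp (‖w‖ ^ 2 / 4), sq_nonneg (‖w‖ - 2)]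
  rw [norm_mul, norm_mul, norm_norm, Real.norm_eq_abs, Real.norm_eq_abs, abs_exp, mul_assoc]
  gcongr
  calc Real.exp (-‖w‖ ^ 2 / 2) * ‖w‖
      ≤ Real.exp (-‖w‖ ^ 2 / 2) * Real.exp (‖w‖ ^ 2 / 4) := by gcongr
    _ = Real.exp (-(1 / 4) * ‖w‖ ^ 2) := by rw [← Real.exp_add]; ring_nf

end GaussianDensity

theorem integral_stdGaussian (d : ℕ) (g : EuclideanSpace ℝ (Fin d) → ℝ) :
    ∫ w, g w ∂(stdGaussian d) =
      ∫ w, ((2 * π) ^ (-(d : ℝ) / 2) * Real.exp (-‖w‖ ^ 2 / 2)) * g w := by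
  rw [stdGaussian, integral_withDensity_eq_integral_toReal_smul (by fun_prop) (by simp)]
  refine integral_congr_ae (.of_forall fun w => ?_)
  simp only [smul_eq_mul]
  rw [ENNReal.toReal_ofReal (by positivity)]

theorem toReal_smoothedKernel_apply (d : ℕ) {σ : ℝ} (hσ : σ ≠ 0) {𝒜 : Type*} [MeasurableSpace 𝒜]
    (p : ProbabilityTheory.Kernel (EuclideanSpace ℝ (Fin d)) 𝒜)
    [ProbabilityTheory.IsMarkovKernel p] (c : EuclideanSpace ℝ (Fin d)) {A : Set 𝒜}
    (hA : MeasurableSet A) :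
    (smoothedKernel d σ p c A).toReal =
      ∫ u, ((2 * π) ^ (-(d : ℝ) / 2) * Real.exp (-‖u - σ⁻¹ • c‖ ^ 2 / 2)) *
        (p (σ • u) A).toReal := by
  have hm : Measurable fun w : EuclideanSpace ℝ (Fin d) => p (c + σ • w) :=
    p.measurable.comp (by fun_prop)
  rw [smoothedKernel, Measure.bind_apply hA hm.aemeasurable,
    ← integral_toReal (Measure.measurable_measure.1 hm A hA).aemeasurable
      (.of_forall fun w => measure_lt_top _ _), integral_stdGaussian,
    ← integral_sub_right_eq_self _ (σ⁻¹ • c)]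
  refine integral_congr_ae (.of_forall fun u => ?_)
  simp [smul_sub, smul_smul, hσ]

/-- **Theorem 1, total-variation form.** Gaussian context smoothing makes the policy Lipschitz
in context: `TV(p_σ(·|c), p_σ(·|c')) ≤ (M_d / σ) · ‖c − c'‖`, where `M_d = ∫ ‖w‖ dγ(w)`. -/
theorem smoothing_tv_lipschitz
    (d : ℕ) (hd : 1 ≤ d) {𝒜 : Type*} [MeasurableSpace 𝒜]
    (p : ProbabilityTheory.Kernel (EuclideanSpace ℝ (Fin d)) 𝒜)
    [ProbabilityTheory.IsMarkovKernel p]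
    (σ : ℝ) (hσ : 0 < σ)
    (M : ℝ) (hM : M = ∫ w, ‖w‖ ∂(stdGaussian d)) :
    ∀ c c' : EuclideanSpace ℝ (Fin d),
      TV (smoothedKernel d σ p c) (smoothedKernel d σ p c') ≤ (M / σ) * ‖c - c'‖ := by
  intro c c'
  set k : ℝ := (2 * π) ^ (-(d : ℝ) / 2)
  have hk : 0 ≤ k := by positivity
  set φ : EuclideanSpace ℝ (Fin d) → ℝ := fun w => k * Real.exp (-‖w‖ ^ 2 / 2) with hφ
  have hφ_smooth : ContDiff ℝ 1 φ := by
    have := contDiff_norm_sq (n := 1) ℝ (E := EuclideanSpace ℝ (Fin d))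
    fun_prop
  have hM_eq : M = ∫ w, φ w * ‖w‖ := by rw [hM, integral_stdGaussian]
  have hM_nonneg : 0 ≤ M := by rw [hM]; positivity
  have hφ' : ∫⁻ x, ‖fderiv ℝ φ x‖ₑ = ENNReal.ofReal M := by
    rw [hM_eq, ofReal_integral_eq_lintegral_ofReal (integrable_exp_neg_norm_sq_div_two_mul_norm k)
      (.of_forall fun w => by positivity)]
    exact lintegral_congr fun x => enorm_fderiv_exp_neg_norm_sq_div_two hk x
  refine ciSup_le fun ⟨A, hA⟩ => ?_
  have hg_meas : Measurable fun u : EuclideanSpace ℝ (Fin d) => (p (σ • u) A).toReal :=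
    ((p.measurable_coe hA).comp (measurable_const_smul σ)).ennreal_toReal
  have hg_le (u : EuclideanSpace ℝ (Fin d)) : ‖(p (σ • u) A).toReal‖ ≤ 1 := by
    rw [Real.norm_of_nonneg ENNReal.toReal_nonneg]
    exact measureReal_le_one
  have hint (a : EuclideanSpace ℝ (Fin d)) :
      Integrable fun u => φ (u - a) * (p (σ • u) A).toReal :=
    ((integrable_exp_neg_norm_sq_div_two k).comp_sub_right a).mul_bdd (c := 1)
      hg_meas.aestronglyMeasurable (.of_forall hg_le)
  have hdiff : (smoothedKernel d σ p c A).toReal - (smoothedKernel d σ p c' A).toReal =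
      ∫ u, (φ (u - σ⁻¹ • c) - φ (u - σ⁻¹ • c')) * (p (σ • u) A).toReal := by
    rw [toReal_smoothedKernel_apply d hσ.ne' p c hA, toReal_smoothedKernel_apply d hσ.ne' p c' hA,
      ← integral_sub (hint _) (hint _)]
    simp only [sub_mul, hφ]
  have key : ‖(smoothedKernel d σ p c A).toReal - (smoothedKernel d σ p c' A).toReal‖ₑ ≤
      ENNReal.ofReal ((M / σ) * ‖c - c'‖) := by
    rw [hdiff]
    calc _ ≤ ∫⁻ u, ‖(φ (u - σ⁻¹ • c) - φ (u - σ⁻¹ • c')) * (p (σ • u) A).toReal‖ₑ :=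
          enorm_integral_le_lintegral_enorm _
      _ ≤ ∫⁻ u, ‖φ (u - σ⁻¹ • c) - φ (u - σ⁻¹ • c')‖ₑ := by
          refine lintegral_mono fun u => enorm_le_iff_norm_le.2 ?_
          rw [norm_mul]
          exact mul_le_of_le_one_right (norm_nonneg _) (hg_le u)
      _ = ∫⁻ u, ‖φ (u + σ⁻¹ • (c' - c)) - φ u‖ₑ := by
          rw [← lintegral_sub_right_eq_self
            (fun u => ‖φ (u + σ⁻¹ • (c' - c)) - φ u‖ₑ) (σ⁻¹ • c')]
          refine lintegral_congr fun u => ?_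
          congr 3
          rw [smul_sub]; abel
      _ ≤ ‖σ⁻¹ • (c' - c)‖ₑ * ∫⁻ x, ‖fderiv ℝ φ x‖ₑ :=
          lintegral_enorm_comp_add_sub_le volume hφ_smooth _
      _ = ENNReal.ofReal ((M / σ) * ‖c - c'‖) := by
          rw [hφ', ← ofReal_norm, ← ENNReal.ofReal_mul (norm_nonneg _), norm_smul, norm_inv,
            Real.norm_of_nonneg hσ.le, norm_sub_rev c' c]
          ring_nf
  rw [← ofReal_norm, ENNReal.ofReal_le_ofReal_iff (by positivity)] at key
  exact key
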